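/- Let u be harmonic on an open set containing the closed ball B(X,2ρ) in ℝ^{n+1}, and suppose U ⊂ B(X,ρ) is an open connected set that is Harnack-chain connected at scale ρ (any two points of U can be joined by a chain of at most N balls of radius ≈ ρ contained in B(X,2ρ)). Then the oscillation of u over U satisfies (osc_U u)² ≤ C ρ^{1-n} ∬_{B(X,2ρ)} |∇u|², with C depending only on n and N. In particular, if osc_U u > ε, then ρ^n ε² ≤ C ∬_{B(X,2ρ)} |∇u(Y)|² dist-to-boundary-comparable weight dY. -/

import Mathlib

open MeasureTheory Metric Set
open scoped ENNReal
noncomputable section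

abbrev Euc (n : ℕ) := EuclideanSpace ℝ (Fin (n + 1))

/-- The Laplacian of `u`, computed in coordinates. -/
noncomputable def lap {n : ℕ} (u : Euc n → ℝ) (x : Euc n) : ℝ :=
  ∑ i : Fin (n + 1),
    fderiv ℝ (fun y => fderiv ℝ u y (EuclideanSpace.single i (1 : ℝ))) x
      (EuclideanSpace.single i (1 : ℝ))

/-- `u` is harmonic on `s`: twice continuously differentiable with vanishing Laplacian. -/
def HarmonicOn {n : ℕ} (u : Euc n → ℝ) (s : Set (Euc n)) : Prop :=
  ContDiffOn ℝ 2 u s ∧ ∀ x ∈ s, lap u x = 0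

def phi {n : ℕ} (y : Euc n) : ℝ := max 0 (1 - ‖y‖ ^ 2)

lemma phi_nonneg {n : ℕ} (y : Euc n) : 0 ≤ phi y := le_max_left _ _

lemma phi_le_one {n : ℕ} (y : Euc n) : phi y ≤ 1 :=
  max_le zero_le_one (by nlinarith [sq_nonneg ‖y‖])

lemma phi_eq_zero {n : ℕ} {y : Euc n} (h : 1 ≤ ‖y‖) : phi y = 0 :=
  max_eq_left (by nlinarith)

lemma phi_continuous {n : ℕ} : Continuous (phi : Euc n → ℝ) := by
  unfold phi; fun_prop

lemma phi_compact {n : ℕ} : HasCompactSupport (phi : Euc n → ℝ) := by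
  apply HasCompactSupport.intro (isCompact_closedBall (0 : Euc n) 1)
  intro y hy
  apply phi_eq_zero
  simp only [mem_closedBall, dist_zero_right, not_le] at hy
  exact hy.le

lemma phi_mul_integrable {n : ℕ} {f : Euc n → ℝ} (hf : Continuous f) :
    Integrable (fun y => f y * phi y) :=
  (hf.mul phi_continuous).integrable_of_hasCompactSupport (phi_compact.mul_left)

lemma phi_integral_pos (n : ℕ) : 0 < ∫ y : Euc n, phi y := by
  apply phi_continuous.integral_pos_of_hasCompactSupport_nonneg_nonzero phi_compact
    (fun y => phi_nonneg y) (x := 0)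
  simp [phi]

lemma hasDerivAt_max_sq (s : ℝ) :
    HasDerivAt (fun t : ℝ => (max 0 t) ^ 2) (2 * max 0 s) s := by
  rcases lt_trichotomy s 0 with h | h | h
  · rw [max_eq_left h.le, mul_zero]
    apply (hasDerivAt_const s (0 : ℝ)).congr_of_eventuallyEq
    filter_upwards [Iio_mem_nhds h] with t ht
    rw [max_eq_left (le_of_lt ht)]; simp
  · subst h
    rw [max_self, mul_zero, hasDerivAt_iff_isLittleO]
    simp only [max_self, sub_zero, smul_zero]
    have : (fun x : ℝ => (max 0 x) ^ 2 - (0 : ℝ) ^ 2) =O[nhds 0] (fun x : ℝ => x ^ 2) := by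
      apply Asymptotics.IsBigO.of_bound 1
      refine Filter.Eventually.of_forall fun x => ?_
      simp only [one_mul, Real.norm_eq_abs]
      rcases le_total x 0 with h | h
      · rw [max_eq_left h]; simp [sq_nonneg]
      · rw [max_eq_right h]; simp
    exact this.trans_isLittleO (Asymptotics.isLittleO_pow_id one_lt_two)
  · rw [max_eq_right h.le]
    have := hasDerivAt_pow 2 s
    simp only [Nat.cast_ofNat, Nat.add_one_sub_one, pow_one] at this
    apply this.congr_of_eventuallyEq
    filter_upwards [Ioi_mem_nhds h] with t ht
    rw [max_eq_right (le_of_lt ht)]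

lemma psi_hasFDerivAt {n : ℕ} (y : Euc n) :
    HasFDerivAt (fun z : Euc n => phi z ^ 2) ((-(4 * phi y)) • innerSL ℝ y) y := by
  have h1 : HasFDerivAt (fun z : Euc n => 1 - ‖z‖ ^ 2) (-(2 • innerSL ℝ y)) y :=
    (hasStrictFDerivAt_norm_sq y).hasFDerivAt.const_sub 1
  have h2 := (hasDerivAt_max_sq (1 - ‖y‖ ^ 2)).comp_hasFDerivAt y h1
  refine h2.congr_fderiv ?_
  ext w
  simp only [smul_apply, neg_apply, innerSL_apply_apply,
    smul_eq_mul, nsmul_eq_mul, phi, Nat.cast_ofNat]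
  ring

lemma psi_fderiv {n : ℕ} (y : Euc n) (i : Fin (n + 1)) :
    fderiv ℝ (fun z : Euc n => phi z ^ 2) y (EuclideanSpace.single i (1 : ℝ))
      = -(4 * phi y) * y i := by
  rw [(psi_hasFDerivAt y).fderiv]
  simp [EuclideanSpace.inner_single_right]

lemma ibp {n : ℕ} {v : Euc n → ℝ} (hv : ContDiff ℝ 2 v) (x : Euc n) (r : ℝ)
    (hl : ∀ y : Euc n, ‖y‖ ≤ 1 → lap v (x + r • y) = 0) :
    ∫ y, fderiv ℝ v (x + r • y) y * phi y = 0 := by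
  set e : Fin (n + 1) → Euc n := fun i => EuclideanSpace.single i (1 : ℝ) with he
  have hd : ∀ i, ContDiff ℝ 1 (fun z => fderiv ℝ v z (e i)) := fun i =>
    (hv.fderiv_right (m := 1) (by norm_num)).clm_apply contDiff_const
  have hw : ∀ i, ContDiff ℝ 1 (fun y => fderiv ℝ v (x + r • y) (e i)) := fun i =>
    (hd i).comp (g := fun z => fderiv ℝ v z (e i)) (f := fun y : Euc n => x + r • y) (by fun_prop)
  have hw' : ∀ i y, fderiv ℝ (fun y => fderiv ℝ v (x + r • y) (e i)) y (e i)
      = r * fderiv ℝ (fun z => fderiv ℝ v z (e i)) (x + r • y) (e i) := by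
    intro i y
    have h1 : HasFDerivAt (fun y : Euc n => x + r • y) (r • ContinuousLinearMap.id ℝ (Euc n)) y :=
      ((hasFDerivAt_id y).const_smul r).const_add x
    have h2 := (((hd i).differentiable one_ne_zero) (x + r • y)).hasFDerivAt.comp y h1
    have h3 := h2.fderiv
    simp only [Function.comp_def] at h3
    rw [h3]
    simp
  have hwc : ∀ i, Continuous (fun y => fderiv ℝ (fun y => fderiv ℝ v (x + r • y) (e i)) y (e i)) :=
    fun i => ((hw i).continuous_fderiv one_ne_zero).clm_apply continuous_const
  have hyi : ∀ i, Continuous (fun y : Euc n => y i) := fun i => by fun_prop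
  have key : ∀ i, ∫ y, (fderiv ℝ v (x + r • y) (e i) * y i) * phi y
      = (1 / 4) * ∫ y, fderiv ℝ (fun y => fderiv ℝ v (x + r • y) (e i)) y (e i) * phi y ^ 2 := by
    intro i
    have := integral_mul_fderiv_eq_neg_fderiv_mul_of_integrable (μ := (volume : Measure (Euc n)))
      (f := fun y => fderiv ℝ v (x + r • y) (e i)) (g := fun z : Euc n => phi z ^ 2) (v := e i)
      ?_ ?_ ?_ ?_ ?_
    · simp only [he, psi_fderiv] at this
      simp only [he]
      rw [← neg_eq_iff_eq_neg] at this
      rw [← this, ← integral_neg, ← integral_const_mul]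
      congr 1; ext y; ring
    · refine (phi_mul_integrable ((hwc i).mul phi_continuous)).congr (ae_of_all _ fun y => ?_)
      simp only [Pi.mul_apply]; ring
    · refine (phi_mul_integrable (((hw i).continuous.mul (hyi i)).mul
        (continuous_const (y := (-4 : ℝ))))).congr (ae_of_all _ fun y => ?_)
      simp only [he, psi_fderiv, Pi.mul_apply]; ring
    · refine (phi_mul_integrable ((hw i).continuous.mul phi_continuous)).congr
        (ae_of_all _ fun y => ?_)
      simp only [Pi.mul_apply]; ring
    · intro y _
      exact (hw i).differentiable one_ne_zero y
    · intro y _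
      exact (psi_hasFDerivAt y).differentiableAt
  have h1 : ∀ y, fderiv ℝ v (x + r • y) y * phi y
      = ∑ i, (fderiv ℝ v (x + r • y) (e i) * y i) * phi y := by
    intro y
    rw [← Finset.sum_mul]
    congr 1
    have hy : y = ∑ i, y i • e i := by
      ext j
      simp [he, Pi.single_apply]
    have h2 := congrArg (fderiv ℝ v (x + r • y)) hy
    rw [map_sum] at h2
    rw [h2]
    simp [mul_comm]
  simp_rw [h1]
  rw [integral_finsetSum _ (fun i _ => phi_mul_integrable
    (f := fun y => fderiv ℝ v (x + r • y) (e i) * y i) ((hw i).continuous.mul (hyi i)))]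
  simp_rw [key]
  rw [← Finset.mul_sum, ← integral_finsetSum]
  · have : ∀ y, ∑ i, fderiv ℝ (fun y => fderiv ℝ v (x + r • y) (e i)) y (e i) * phi y ^ 2 = 0 := by
      intro y
      rw [← Finset.sum_mul]
      rcases le_total ‖y‖ 1 with h | h
      · simp_rw [hw']
        rw [← Finset.mul_sum]
        have := hl y h
        unfold lap at this
        rw [this]; simp
      · rw [phi_eq_zero h]; simp
    simp [this]
  · intro i _
    refine (phi_mul_integrable ((hwc i).mul phi_continuous)).congr (ae_of_all _ fun y => ?_)
    simp only [Pi.mul_apply]; ring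

lemma deriv_param {n : ℕ} {v : Euc n → ℝ} (hv : ContDiff ℝ 2 v) (hc : HasCompactSupport v)
    {a b : Euc n → Euc n} (ha : Continuous a) (hb : Continuous b) (t : ℝ) :
    HasDerivAt (fun t : ℝ => ∫ y, v (a y + t • b y) * phi y)
      (∫ y, fderiv ℝ v (a y + t • b y) (b y) * phi y) t := by
  have hdc : Continuous (fderiv ℝ v) := hv.continuous_fderiv two_ne_zero
  obtain ⟨M, hM⟩ := hdc.bounded_above_of_compact_support (hc.fderiv ℝ)
  have hcont : ∀ t : ℝ, Continuous (fun y => a y + t • b y) := fun t => by fun_prop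
  refine (hasDerivAt_integral_of_dominated_loc_of_deriv_le (F := fun t y => v (a y + t • b y) * phi y)
    (F' := fun t y => fderiv ℝ v (a y + t • b y) (b y) * phi y)
    (bound := fun y => (M * ‖b y‖) * phi y) (s := univ) Filter.univ_mem ?_ ?_ ?_ ?_ ?_ ?_).2
  · exact Filter.Eventually.of_forall fun t =>
      (phi_mul_integrable (hv.continuous.comp (hcont t))).aestronglyMeasurable
  · exact phi_mul_integrable (hv.continuous.comp (hcont t))
  · exact (phi_mul_integrable ((hdc.comp (hcont t)).clm_apply hb)).aestronglyMeasurable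
  · refine ae_of_all _ fun y s _ => ?_
    rw [norm_mul, Real.norm_of_nonneg (phi_nonneg y)]
    refine mul_le_mul_of_nonneg_right ?_ (phi_nonneg y)
    refine (ContinuousLinearMap.le_opNorm _ _).trans ?_
    exact mul_le_mul_of_nonneg_right (hM _) (norm_nonneg _)
  · exact phi_mul_integrable (continuous_const.mul hb.norm)
  · refine ae_of_all _ fun y s _ => ?_
    apply HasDerivAt.mul_const
    have h1 : HasDerivAt (fun s : ℝ => a y + s • b y) (b y) s := by
      simpa using ((hasDerivAt_id s).smul_const (b y)).const_add (a y)
    exact ((hv.differentiable two_ne_zero) _).hasFDerivAt.comp_hasDerivAt s h1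

lemma mean_value {n : ℕ} {v : Euc n → ℝ} (hv : ContDiff ℝ 2 v) (hc : HasCompactSupport v)
    (x : Euc n) {ρ : ℝ} (hρ : 0 < ρ) (hl : ∀ z ∈ closedBall x ρ, lap v z = 0) :
    ∫ y, v (x + ρ • y) * phi y = v x * ∫ y : Euc n, phi y := by
  have h := norm_image_sub_le_of_norm_deriv_le_segment_01' (C := 0)
    (f := fun t : ℝ => ∫ y, v (x + t • (ρ • y)) * phi y)
    (f' := fun t : ℝ => ∫ y, fderiv ℝ v (x + t • (ρ • y)) (ρ • y) * phi y)
    (fun t _ => (deriv_param hv hc continuous_const (by fun_prop) t).hasDerivWithinAt) ?_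
  · simp only [one_smul, zero_smul, add_zero, norm_le_zero_iff] at h
    rw [integral_const_mul] at h
    linarith
  · intro t ht
    have := ibp hv x (t * ρ) (fun y hy => hl _ ?_)
    · simp only [map_smul, smul_eq_mul, mul_assoc, integral_const_mul, smul_smul, this]
      simp
    · rw [mem_closedBall, dist_eq_norm, add_sub_cancel_left, norm_smul,
        Real.norm_of_nonneg (mul_nonneg ht.1 hρ.le)]
      have : t * ρ ≤ ρ := by nlinarith [ht.2]
      have := mul_nonneg ht.1 hρ.le
      nlinarith [norm_nonneg y]

lemma phi_cs {n : ℕ} {f : Euc n → ℝ} (hf : Continuous f) :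
    (∫ y, f y * phi y) ^ 2 ≤ (∫ y : Euc n, phi y) * ∫ y, f y ^ 2 * phi y := by
  set I := ∫ y : Euc n, phi y with hI
  have hIp : 0 < I := phi_integral_pos n
  set A := ∫ y, f y * phi y with hA
  have h0 : 0 ≤ ∫ y, (f y * I - A) ^ 2 * phi y :=
    integral_nonneg fun y => mul_nonneg (sq_nonneg _) (phi_nonneg y)
  have h1 : ∫ y, (f y * I - A) ^ 2 * phi y
      = I ^ 2 * (∫ y, f y ^ 2 * phi y) - 2 * I * A * A + A ^ 2 * I := by
    have i1 := (phi_mul_integrable (f := fun y => f y ^ 2) (hf.pow 2)).const_mul (I ^ 2)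
    have i2 := (phi_mul_integrable hf).const_mul (2 * I * A)
    have i3 := (phi_continuous.integrable_of_hasCompactSupport (phi_compact (n := n))
      (μ := volume)).const_mul (A ^ 2)
    have j1 : ∫ y, I ^ 2 * (f y ^ 2 * phi y) = I ^ 2 * (∫ y, f y ^ 2 * phi y) :=
      integral_const_mul _ _
    have j2 : ∫ y, 2 * I * A * (f y * phi y) = 2 * I * A * A := integral_const_mul _ _
    have j3 : ∫ y : Euc n, A ^ 2 * phi y = A ^ 2 * I := integral_const_mul _ _
    rw [← j1, ← j2, ← j3, ← integral_sub i1 i2, ← integral_add (f := fun a => I ^ 2 * (f a ^ 2 * phi a) - 2 * I * A * (f a * phi a))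
      (i1.sub i2) i3]
    refine integral_congr_ae (ae_of_all _ fun y => ?_)
    simp only
    ring
  rw [h1] at h0
  have : 0 ≤ I * (I * (∫ y, f y ^ 2 * phi y) - A ^ 2) := by nlinarith
  have := nonneg_of_mul_nonneg_right this hIp
  linarith

lemma grad_sq_integrable {n : ℕ} {v : Euc n → ℝ} (hv : ContDiff ℝ 2 v)
    (hc : HasCompactSupport v) : Integrable (fun W => ‖fderiv ℝ v W‖ ^ 2) := by
  have h1 : HasCompactSupport (fun W => ‖fderiv ℝ v W‖) := (hc.fderiv ℝ).norm
  have h2 : Continuous (fun W => ‖fderiv ℝ v W‖) := (hv.continuous_fderiv two_ne_zero).norm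
  simp_rw [sq]
  exact (h2.mul h2).integrable_of_hasCompactSupport h1.mul_left

lemma main_bound {n : ℕ} {v : Euc n → ℝ} (hv : ContDiff ℝ 2 v) (hc : HasCompactSupport v)
    (X : Euc n) {ρ : ℝ} (hρ : 0 < ρ) (hl : ∀ z ∈ closedBall X (2 * ρ), lap v z = 0)
    {Y Z : Euc n} (hY : Y ∈ ball X ρ) (hZ : Z ∈ ball X ρ) :
    (v Y - v Z) ^ 2 ≤ (4 / ∫ y : Euc n, phi y) * ρ / ρ ^ n *
      ∫ W in ball X (2 * ρ), ‖fderiv ℝ v W‖ ^ 2 := by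
  have hdc : Continuous (fderiv ℝ v) := hv.continuous_fderiv two_ne_zero
  set I := ∫ y : Euc n, phi y with hI
  have hIp : 0 < I := phi_integral_pos n
  set J := ∫ W in ball X (2 * ρ), ‖fderiv ℝ v W‖ ^ 2 with hJ
  have hJ0 : 0 ≤ J := integral_nonneg fun y => sq_nonneg _
  have hmv : ∀ W ∈ ball X ρ, ∫ y, v (W + ρ • y) * phi y = v W * I := by
    intro W hW
    refine mean_value hv hc W hρ fun z hz => hl z ?_
    refine closedBall_subset_closedBall' ?_ hz
    rw [mem_ball] at hW; linarith
  -- the gradient bound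
  have hgrad : ∀ W ∈ ball X ρ,
      ∫ y, ‖fderiv ℝ v (W + ρ • y)‖ ^ 2 * phi y ≤ (ρ ^ (n + 1))⁻¹ * J := by
    intro W hW
    set g : Euc n → ℝ := (ball X (2 * ρ)).indicator (fun W => ‖fderiv ℝ v W‖ ^ 2) with hg
    have hgi : Integrable g := by
      rw [hg, integrable_indicator_iff measurableSet_ball]
      exact (grad_sq_integrable hv hc).integrableOn
    have h1 : ∫ y, g (W + ρ • y) = (ρ ^ (n + 1))⁻¹ * J := by
      have := Measure.integral_comp_smul_of_nonneg (volume : Measure (Euc n))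
        (fun y => g (W + y)) ρ (hR := hρ.le)
      rw [this, integral_add_left_eq_self g W, hg, integral_indicator measurableSet_ball]
      simp [hJ]
    rw [← h1]
    refine integral_mono (phi_mul_integrable (f := fun y => ‖fderiv ℝ v (W + ρ • y)‖ ^ 2) ?_) ?_ ?_
    · exact ((hdc.comp (by fun_prop)).norm.pow 2)
    · exact (hgi.comp_add_left W).comp_smul hρ.ne'
    · intro y
      simp only
      rcases lt_or_ge ‖y‖ 1 with h | h
      · have hm : W + ρ • y ∈ ball X (2 * ρ) := by
          rw [mem_ball] at hW ⊢
          rw [dist_eq_norm] at hW ⊢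
          calc ‖W + ρ • y - X‖ = ‖(W - X) + ρ • y‖ := by congr 1; abel
            _ ≤ ‖W - X‖ + ‖ρ • y‖ := norm_add_le _ _
            _ < 2 * ρ := by
              rw [norm_smul, Real.norm_of_nonneg hρ.le]
              nlinarith
        rw [hg, indicator_of_mem hm]
        nlinarith [sq_nonneg ‖fderiv ℝ v (W + ρ • y)‖, phi_le_one y]
      · rw [phi_eq_zero h, mul_zero]
        exact indicator_nonneg (fun _ _ => sq_nonneg _) _
  set K := Real.sqrt (I * ((ρ ^ (n + 1))⁻¹ * J)) with hK
  have hKsq : K ^ 2 = I * ((ρ ^ (n + 1))⁻¹ * J) := Real.sq_sqrt (by positivity)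
  have h := norm_image_sub_le_of_norm_deriv_le_segment_01' (C := K * (2 * ρ))
    (f := fun t : ℝ => ∫ y, v ((Z + ρ • y) + t • (Y - Z)) * phi y)
    (f' := fun t : ℝ => ∫ y, fderiv ℝ v ((Z + ρ • y) + t • (Y - Z)) (Y - Z) * phi y)
    (fun t _ => (deriv_param hv hc (by fun_prop) continuous_const t).hasDerivWithinAt) ?_
  · have e1 : ∀ y : Euc n, (Z + ρ • y) + (Y - Z) = Y + ρ • y := fun y => by abel
    simp only [one_smul, zero_smul, add_zero, e1] at h
    rw [hmv Y hY, hmv Z hZ, Real.norm_eq_abs] at h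
    have h2 : (v Y * I - v Z * I) ^ 2 ≤ (K * (2 * ρ)) ^ 2 := by
      rw [← sq_abs]
      exact pow_le_pow_left₀ (abs_nonneg _) h 2
    rw [mul_pow, hKsq, ← sub_mul, mul_pow] at h2
    have h3 : (4 / I) * ρ / ρ ^ n * J
        = (I * ((ρ ^ (n + 1))⁻¹ * J) * (2 * ρ) ^ 2) / I ^ 2 := by
      field_simp
      ring
    rw [h3, le_div_iff₀ (by positivity)]
    exact h2
  · intro t ht
    have hW : Z + t • (Y - Z) ∈ ball X ρ := 
      (convex_ball X ρ).add_smul_sub_mem hZ hY ⟨ht.1, ht.2.le⟩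
    have e1 : ∀ y : Euc n, (Z + ρ • y) + t • (Y - Z) = (Z + t • (Y - Z)) + ρ • y :=
      fun y => by abel
    simp only [e1]
    set W := Z + t • (Y - Z) with hWd
    have hfc : Continuous (fun y => ‖fderiv ℝ v (W + ρ • y)‖) := (hdc.comp (by fun_prop)).norm
    have hYZ : ‖Y - Z‖ ≤ 2 * ρ := by
      rw [← dist_eq_norm]
      have := dist_triangle_right Y Z X
      rw [mem_ball] at hY hZ; linarith
    calc ‖∫ y, fderiv ℝ v (W + ρ • y) (Y - Z) * phi y‖
        ≤ ∫ y, (‖fderiv ℝ v (W + ρ • y)‖ * phi y) * (2 * ρ) := by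
          refine norm_integral_le_of_norm_le ((phi_mul_integrable hfc).mul_const _)
            (ae_of_all _ fun y => ?_)
          rw [norm_mul, Real.norm_of_nonneg (phi_nonneg y)]
          calc _ ≤ (‖fderiv ℝ v (W + ρ • y)‖ * ‖Y - Z‖) * phi y :=
                mul_le_mul_of_nonneg_right (ContinuousLinearMap.le_opNorm _ _) (phi_nonneg y)
            _ ≤ (‖fderiv ℝ v (W + ρ • y)‖ * (2 * ρ)) * phi y := by
                have := phi_nonneg y
                gcongr
            _ = _ := by ring
      _ = (∫ y, ‖fderiv ℝ v (W + ρ • y)‖ * phi y) * (2 * ρ) := integral_mul_const _ _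
      _ ≤ K * (2 * ρ) := by
          refine mul_le_mul_of_nonneg_right ?_ (by positivity)
          refine Real.le_sqrt_of_sq_le ((phi_cs hfc).trans ?_)
          exact mul_le_mul_of_nonneg_left (hgrad W hW) hIp.le

lemma exists_ext {n : ℕ} {Ω : Set (Euc n)} {u : Euc n → ℝ} {X : Euc n} {R : ℝ} (hR : 0 < R)
    (hΩ : IsOpen Ω) (hb : closedBall X R ⊆ Ω) (hu : ContDiffOn ℝ 2 u Ω) :
    ∃ v : Euc n → ℝ, ContDiff ℝ 2 v ∧ HasCompactSupport v ∧
      ∀ x ∈ closedBall X R, v =ᶠ[nhds x] u := by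
  obtain ⟨δ, hδ, hsub⟩ := (isCompact_closedBall X R).exists_cthickening_subset_open hΩ hb
  rw [cthickening_closedBall hδ.le hR.le] at hsub
  let f : ContDiffBump X := ⟨R + δ / 2, R + δ, by positivity, by linarith⟩
  refine ⟨fun x => f x * u x, ?_, f.hasCompactSupport.mul_right, ?_⟩
  · rw [contDiff_iff_contDiffAt]
    intro x
    by_cases hx : x ∈ Ω
    · exact f.contDiff.contDiffAt.mul (hu.contDiffAt (hΩ.mem_nhds hx))
    · have hx' : x ∉ tsupport f := by
        rw [f.tsupport_eq]
        intro h
        apply hx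
        apply hsub
        rw [mem_closedBall] at h ⊢
        exact h.trans (le_of_eq (add_comm R δ))
      have : (fun x => f x * u x) =ᶠ[nhds x] fun _ => 0 := by
        rw [notMem_tsupport_iff_eventuallyEq] at hx'
        filter_upwards [hx'] with z hz
        simp [hz]
      exact contDiffAt_const.congr_of_eventuallyEq this
  · intro x hx
    have : x ∈ ball X f.rIn := by
      rw [mem_closedBall] at hx
      rw [mem_ball]
      change dist x X < R + δ / 2
      linarith
    filter_upwards [f.eventuallyEq_one_of_mem_ball this] with z hz
    simp [hz]

/-- If `u` is harmonic on a neighborhood of `closedBall X (2ρ)` and `U ⊂ B(X,ρ)` is an open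
connected set which is Harnack-chain connected at scale `ρ` (chains of at most `N` balls of
radius `≈ ρ` inside `B(X,2ρ)`), then `(osc_U u)² ≤ C ρ^{1-n} ∬_{B(X,2ρ)} |∇u|²`, with `C`
depending only on `n` and `N`. -/
theorem statement9 (n N : ℕ) :
    ∃ C : ℝ, 0 < C ∧
      ∀ (Ω U : Set (Euc n)) (u : Euc n → ℝ) (X : Euc n) (ρ : ℝ),
        0 < ρ → IsOpen Ω → Metric.closedBall X (2 * ρ) ⊆ Ω → HarmonicOn u Ω →
        IsOpen U → IsConnected U → U ⊆ Metric.ball X ρ →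
        (∀ Y ∈ U, ∀ Z ∈ U, ∃ m : ℕ, m + 1 ≤ N ∧
          ∃ c : Fin (m + 1) → Euc n, ∃ s : Fin (m + 1) → ℝ,
            (∀ i, ρ / (N + 1) ≤ s i ∧ s i ≤ ρ ∧
              Metric.ball (c i) (s i) ⊆ Metric.ball X (2 * ρ)) ∧
            Y ∈ Metric.ball (c 0) (s 0) ∧
            Z ∈ Metric.ball (c (Fin.last m)) (s (Fin.last m)) ∧
            ∀ i : Fin m, (Metric.ball (c i.castSucc) (s i.castSucc) ∩
              Metric.ball (c i.succ) (s i.succ)).Nonempty) →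
        ∀ Y ∈ U, ∀ Z ∈ U,
          ENNReal.ofReal ((u Y - u Z) ^ 2) ≤
            ENNReal.ofReal (C * ρ / ρ ^ n) *
              ∫⁻ W in Metric.ball X (2 * ρ), ENNReal.ofReal (‖fderiv ℝ u W‖ ^ 2) := by
  refine ⟨4 / ∫ y : Euc n, phi y, div_pos four_pos (phi_integral_pos n), ?_⟩
  intro Ω U u X ρ hρ hΩ hsub hu _ _ hU _ Y hY Z hZ
  obtain ⟨v, hv, hc, hvu⟩ := exists_ext (by positivity : 0 < 2 * ρ) hΩ hsub hu.1
  have hl : ∀ z ∈ closedBall X (2 * ρ), lap v z = 0 := by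
    intro z hz
    rw [← hu.2 z (hsub hz)]
    unfold lap
    refine Finset.sum_congr rfl fun i _ => ?_
    have h1 : (fun y => fderiv ℝ v y (EuclideanSpace.single i (1 : ℝ))) =ᶠ[nhds z]
        (fun y => fderiv ℝ u y (EuclideanSpace.single i (1 : ℝ))) := by
      filter_upwards [(hvu z hz).fderiv (𝕜 := ℝ)] with y hy
      rw [hy]
    rw [h1.fderiv_eq]
  have hb := main_bound hv hc X hρ hl (hU hY) (hU hZ)
  have hsb : ball X ρ ⊆ closedBall X (2 * ρ) :=
    ball_subset_closedBall.trans (closedBall_subset_closedBall (by linarith))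
  rw [(hvu Y (hsb (hU hY))).eq_of_nhds, (hvu Z (hsb (hU hZ))).eq_of_nhds] at hb
  refine (ENNReal.ofReal_le_ofReal hb).trans ?_
  have hI := phi_integral_pos n
  rw [ENNReal.ofReal_mul (by positivity)]
  refine mul_le_mul_right ?_ _
  have hint : Integrable (fun W => ‖fderiv ℝ v W‖ ^ 2) (volume.restrict (ball X (2 * ρ))) := by
    exact (grad_sq_integrable hv hc).integrableOn
  rw [ofReal_integral_eq_lintegral_ofReal hint (ae_of_all _ fun _ => sq_nonneg _)]
  refine le_of_eq (setLIntegral_congr_fun measurableSet_ball fun W hW => ?_)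
  simp only [(hvu W (ball_subset_closedBall hW)).fderiv_eq]
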